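/- The unbounded octant tiling problem is undecidable: the predicate on tiling instances that holds of (k, H, V, t_I, t_F) if and only if the instance is well-formed and there exists some n ∈ ℕ and a successful tiling of the n-th octant, is not a computable (decidable) predicate. -/

import Mathlib

/-- A tiling instance `(k, H, V, t_I, t_F)`: `k` is the number of tiles
(tiles are `0, …, k-1`), `H` and `V` are the horizontal and vertical
matching relations given as lists of pairs, and `t_I`, `t_F` are the initial
and final tiles. -/
abbrev TilingInstance : Type := ℕ × List (ℕ × ℕ) × List (ℕ × ℕ) × ℕ × ℕ

/-- The instance is well-formed: `t_I < k`, `t_F < k`, and every entry of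
every pair in `H` and `V` is `< k`. -/
def WellFormed : TilingInstance → Prop :=
  fun (k, H, V, tI, tF) =>
    tI < k ∧ tF < k ∧
    (∀ p ∈ H, p.1 < k ∧ p.2 < k) ∧
    (∀ p ∈ V, p.1 < k ∧ p.2 < k)

/-- There exist `n : ℕ` and a successful tiling of the `n`-th octant
`O_n = {(i, j) : j ≤ i ≤ n}`: a map `τ` into `{0, …, k-1}` respecting the
horizontal relation `H` in rows and the vertical relation `V` in columns,
with `τ 0 0 = t_I` and `τ i i = t_F` for some `i ≤ n`. -/
def HasSuccessfulTiling : TilingInstance → Prop :=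
  fun (k, H, V, tI, tF) =>
    ∃ n : ℕ, ∃ τ : ℕ → ℕ → ℕ,
      (∀ i j : ℕ, j ≤ i → i ≤ n → τ i j < k) ∧
      (∀ i j : ℕ, j < i → i ≤ n → (τ i j, τ i (j + 1)) ∈ H) ∧
      (∀ i j : ℕ, j ≤ i → i < n → (τ i j, τ (i + 1) j) ∈ V) ∧
      τ 0 0 = tI ∧
      (∃ i : ℕ, i ≤ n ∧ τ i i = tF)

open Turing Function

namespace OctantTiling

/-- An operation on a family of stacks indexed by `K` with entries in `Γ`. -/
inductive StackOp (K Γ : Type)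
  | nop
  | push (k : K) (a : Γ)
  | pop (k : K)
  | clear

section Machine

variable {K Γ : Type}

/-- The entries at depth `j` of all the stacks. -/
def column (S : K → List Γ) (j : ℕ) : K → Option Γ := fun k => (S k)[j]?

/-- The column preceding column `j`, if there is one. -/
def leftColumn (S : K → List Γ) : ℕ → Option (K → Option Γ)
  | 0 => none
  | j + 1 => some (column S j)

theorem leftColumn_eq_none {S : K → List Γ} {j : ℕ} : leftColumn S j = none ↔ j = 0 := by
  cases j <;> simp [leftColumn]

/-- A tile without its control state: the columns at the top of the stacks, to the left, in the
middle and to the right, and a flag which is `0` on the diagonal, `1` just below it and `2`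
elsewhere. -/
abbrev Cell (K Γ : Type) : Type :=
  (K → Option Γ) × Option (K → Option Γ) × (K → Option Γ) × (K → Option Γ) × Fin 3

/-- The cell at position `(i, j)` when the stacks at time `i` are `S`. -/
def cellAt (S : K → List Γ) (i j : ℕ) : Cell K Γ :=
  (column S 0, leftColumn S j, column S j, column S (j + 1),
    if j = i then 0 else if j + 1 = i then 1 else 2)

/-- The horizontal compatibility of cells. -/
def HorizontalOk (r r' : Cell K Γ) : Prop :=
  r'.1 = r.1 ∧ r'.2.1 = some r.2.2.1 ∧ r.2.2.2.1 = r'.2.2.1 ∧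
    (r.2.2.2.2 = 1 ↔ r'.2.2.2.2 = 0) ∧
    (r'.2.2.2.2 = 0 → r'.2.2.1 = (fun _ => none) ∧ r'.2.2.2.1 = (fun _ => none))

theorem horizontalOk_cellAt {S : K → List Γ} {i j : ℕ} (hS : ∀ k, (S k).length ≤ i)
    (hj : j < i) : HorizontalOk (cellAt S i j) (cellAt S i (j + 1)) := by
  refine ⟨rfl, rfl, rfl, ?_, ?_⟩
  · simp only [cellAt]
    split_ifs <;> simp_all
  · intro h
    have hi : j + 1 = i := by
      by_contra hne
      simp only [cellAt, if_neg hne] at h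
      split_ifs at h <;> simp at h
    constructor <;> funext k <;> have := hS k <;> simp [cellAt, column] <;> omega

theorem cellAt_diagonal_eq {S : K → List Γ} {i : ℕ} :
    cellAt S i i = cellAt (fun _ => []) 1 1 ↔ i ≠ 0 ∧ S = fun _ => [] := by
  constructor
  · intro h
    constructor
    · rintro rfl
      simp [cellAt, leftColumn] at h
    · funext k
      have := congrFun (congrArg Prod.fst h) k
      simpa [cellAt, column] using this
  · rintro ⟨hi, rfl⟩
    obtain ⟨i, rfl⟩ := Nat.exists_eq_succ_of_ne_zero hi
    simp [cellAt, leftColumn, funext_iff, column]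

section Loader

variable [Inhabited Γ] (δ : ℕ → (K → Option Γ) → ℕ × StackOp K Γ) (B : ℕ) (k : K)

/-- Extend a machine with control states `0, …, B` by states `B + 1, B + 2, …` which push the
word `w` on stack `k`, last letter first, before entering state `B`. -/
def loader (w : List Γ) (s : ℕ) (a : K → Option Γ) : ℕ × StackOp K Γ :=
  if s ≤ B then δ s a else (s - 1, StackOp.push k (w.getD (s - 1 - B) default))

variable {δ B k}

theorem loader_lt (hδ : ∀ s ≤ B, ∀ a, (δ s a).1 ≤ B) {w : List Γ} {s : ℕ}
    (hs : s < B + w.length + 1) (a : K → Option Γ) :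
    (loader δ B k w s a).1 < B + w.length + 1 := by
  unfold loader
  split_ifs with h
  · have := hδ s h a
    omega
  · dsimp only
    omega

end Loader

section Codes

variable [Finite K] [Finite Γ]

/-- A numbering of the cells. -/
noncomputable def cellCode (r : Cell K Γ) : ℕ := Finite.equivFin (Cell K Γ) r

/-- The number of the tile with the given control state and cell. -/
noncomputable def tileCode (s : ℕ) (r : Cell K Γ) : ℕ := Nat.pair s (cellCode r)

theorem tileCode_injective2 : Injective2 (tileCode (K := K) (Γ := Γ)) := by
  intro s s' r r' h
  simpa [tileCode, cellCode, Fin.val_inj] using h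

theorem tileCode_lt {s N : ℕ} (hs : s < N) (r : Cell K Γ) :
    tileCode s r < Nat.pair N (Nat.card (Cell K Γ)) :=
  (Nat.pair_lt_pair_left _ hs).trans (Nat.pair_lt_pair_right _ (Fin.is_lt _))

/-- The list of the codes of the pairs of cells which satisfy `P`. -/
noncomputable def codePairs (P : Cell K Γ → Cell K Γ → Prop) : List (ℕ × ℕ) :=
  (Set.toFinite {p : Cell K Γ × Cell K Γ | P p.1 p.2}).toFinset.toList.map
    (Prod.map cellCode cellCode)

theorem mem_codePairs {P : Cell K Γ → Cell K Γ → Prop} {p : ℕ × ℕ} :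
    p ∈ codePairs P ↔ ∃ r r', P r r' ∧ p = (cellCode r, cellCode r') := by
  simp only [codePairs, List.mem_map, Finset.mem_toList, Set.Finite.mem_toFinset,
    Set.mem_ofPred_eq]
  constructor
  · rintro ⟨⟨r, r'⟩, h, rfl⟩
    exact ⟨r, r', h, rfl⟩
  · rintro ⟨r, r', h, rfl⟩
    exact ⟨(r, r'), h, rfl⟩

/-- Put the control states `s` and `s'` on a pair of codes of cells. -/
def withStates (s s' : ℕ) (p : ℕ × ℕ) : ℕ × ℕ := (Nat.pair s p.1, Nat.pair s' p.2)

variable (K Γ) in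
/-- The horizontal relation between tiles with control state less than `N`. -/
noncomputable def horizontalList (N : ℕ) : List (ℕ × ℕ) :=
  (List.range N).flatMap fun s => (codePairs (HorizontalOk (K := K) (Γ := Γ))).map (withStates s s)

theorem mem_horizontalList {N : ℕ} {p : ℕ × ℕ} : p ∈ horizontalList K Γ N ↔
    ∃ s < N, ∃ r r' : Cell K Γ, HorizontalOk r r' ∧ p = (tileCode s r, tileCode s r') := by
  simp only [horizontalList, List.mem_flatMap, List.mem_range, List.mem_map, mem_codePairs]
  constructor
  · rintro ⟨s, hs, _, ⟨r, r', h, rfl⟩, rfl⟩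
    exact ⟨s, hs, r, r', h, rfl⟩
  · rintro ⟨s, hs, r, r', h, rfl⟩
    exact ⟨s, hs, _, ⟨r, r', h, rfl⟩, rfl⟩

end Codes

variable [DecidableEq K]

/-- The effect of an operation on the stacks. -/
def StackOp.run : StackOp K Γ → (K → List Γ) → K → List Γ
  | nop, S => S
  | push k a, S => update S k (a :: S k)
  | pop k, S => update S k (S k).tail
  | clear, _ => fun _ => []

/-- The effect of an operation on a column, given its neighbours. -/
def StackOp.cell : StackOp K Γ → Option (K → Option Γ) → (K → Option Γ) → (K → Option Γ) →
    K → Option Γ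
  | nop, _, m, _ => m
  | push k a, l, m, _ => update m k (l.elim (some a) fun c => c k)
  | pop k, _, m, r => update m k (r k)
  | clear, _, _, _ => fun _ => none

theorem column_run (o : StackOp K Γ) (S : K → List Γ) (j : ℕ) :
    column (o.run S) j = o.cell (leftColumn S j) (column S j) (column S (j + 1)) := by
  funext k'
  cases o with
  | nop => rfl
  | push k a =>
    rcases eq_or_ne k' k with rfl | h <;> cases j <;>
      simp [column, leftColumn, StackOp.run, StackOp.cell, *]
  | pop k =>
    rcases eq_or_ne k' k with rfl | h <;>
      simp [column, StackOp.run, StackOp.cell, *]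
  | clear => simp [column, StackOp.run, StackOp.cell]

theorem length_run_le {o : StackOp K Γ} {S : K → List Γ} {i : ℕ} (hS : ∀ k, (S k).length ≤ i)
    (k : K) : (o.run S k).length ≤ i + 1 := by
  have hk := hS k
  cases o with
  | nop => exact hk.trans i.le_succ
  | push k' a =>
    rcases eq_or_ne k k' with rfl | h <;> simp [StackOp.run, *]; omega
  | pop k' =>
    rcases eq_or_ne k k' with rfl | h <;> simp [StackOp.run, *] <;> omega
  | clear => simp [StackOp.run]

/-- The vertical compatibility of cells when the operation `o` is performed. -/
def VerticalOk (o : StackOp K Γ) (r r' : Cell K Γ) : Prop :=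
  r'.2.2.1 = o.cell r.2.1 r.2.2.1 r.2.2.2.1 ∧
    r'.2.2.2.2 = (if r.2.2.2.2 = 0 then 1 else 2) ∧ (r'.2.1 = none ↔ r.2.1 = none) ∧
    (r'.2.1 = none → r'.1 = r'.2.2.1)

theorem verticalOk_cellAt (o : StackOp K Γ) (S : K → List Γ) {i j : ℕ} (hj : j ≤ i) :
    VerticalOk o (cellAt S i j) (cellAt (o.run S) (i + 1) j) := by
  refine ⟨column_run .., ?_, ?_, ?_⟩
  · simp only [cellAt]
    split_ifs <;> simp_all
  · simp [cellAt, leftColumn_eq_none]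
  · intro h
    obtain rfl := leftColumn_eq_none.1 h
    rfl

/-- A step of the machine with transition function `δ`. -/
def machineStep {Q : Type} (δ : Q → (K → Option Γ) → Q × StackOp K Γ) (c : Q × (K → List Γ)) :
    Q × (K → List Γ) :=
  ((δ c.1 (column c.2 0)).1, (δ c.1 (column c.2 0)).2.run c.2)

theorem length_iterate_le {Q : Type} (δ : Q → (K → Option Γ) → Q × StackOp K Γ) (q : Q) (i : ℕ)
    (k : K) : (((machineStep δ)^[i] (q, fun _ => [])).2 k).length ≤ i := by
  induction i generalizing k with
  | zero => simp
  | succ i ih =>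
    rw [iterate_succ_apply']
    exact length_run_le ih k

/-- The tile at position `(i, j)` of the tiling which represents the run of a machine. -/
def runTile (enc : ℕ → Cell K Γ → ℕ) (δ : ℕ → (K → Option Γ) → ℕ × StackOp K Γ) (s i j : ℕ) : ℕ :=
  enc ((machineStep δ)^[i] (s, fun _ => [])).1
    (cellAt ((machineStep δ)^[i] (s, fun _ => [])).2 i j)

theorem eq_runTile {enc : ℕ → Cell K Γ → ℕ} (henc : Injective2 enc)
    {δ : ℕ → (K → Option Γ) → ℕ × StackOp K Γ} {H V : List (ℕ × ℕ)}
    (hH : ∀ p ∈ H, ∃ s r r', HorizontalOk r r' ∧ p = (enc s r, enc s r'))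
    (hV : ∀ p ∈ V, ∃ s r r', VerticalOk (δ s r.1).2 r r' ∧ p = (enc s r, enc (δ s r.1).1 r'))
    {τ : ℕ → ℕ → ℕ} {n s : ℕ}
    (hτH : ∀ i j : ℕ, j < i → i ≤ n → (τ i j, τ i (j + 1)) ∈ H)
    (hτV : ∀ i j : ℕ, j ≤ i → i < n → (τ i j, τ (i + 1) j) ∈ V)
    (h0 : τ 0 0 = runTile enc δ s 0 0) {i : ℕ} (hi : i ≤ n) :
    ∀ j ≤ i, τ i j = runTile enc δ s i j := by
  induction i with
  | zero =>
    intro j hj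
    obtain rfl : j = 0 := by omega
    exact h0
  | succ i ih =>
    specialize ih (by omega)
    simp only [runTile, iterate_succ_apply'] at ih ⊢
    have hlen := length_iterate_le δ s i
    set c := (machineStep δ)^[i] (s, fun _ => []) with hc
    have hlen' : ∀ k, ((machineStep δ c).2 k).length ≤ i + 1 := length_run_le hlen
    have below : ∀ j ≤ i, ∃ r, τ (i + 1) j = enc (machineStep δ c).1 r ∧
        VerticalOk (δ c.1 (column c.2 0)).2 (cellAt c.2 i j) r := by
      intro j hj
      obtain ⟨s, r, r', hok, hp⟩ := hV _ (hτV i j hj hi)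
      rw [ih j hj, Prod.mk.injEq] at hp
      obtain ⟨rfl, rfl⟩ := henc hp.1
      exact ⟨r', hp.2, hok⟩
    have pair : ∀ j ≤ i, ∃ t r r', HorizontalOk r r' ∧ τ (i + 1) j = enc t r ∧
        τ (i + 1) (j + 1) = enc t r' := by
      intro j hj
      obtain ⟨t, r, r', hok, hp⟩ := hH _ (hτH (i + 1) j (by omega) hi)
      exact ⟨t, r, r', hok, (Prod.mk.injEq .. ▸ hp).1, (Prod.mk.injEq .. ▸ hp).2⟩
    have row : ∀ j ≤ i + 1, ∃ r, τ (i + 1) j = enc (machineStep δ c).1 r ∧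
        r.2.2.1 = column (machineStep δ c).2 j ∧
        r.2.2.2.2 = (cellAt (machineStep δ c).2 (i + 1) j).2.2.2.2 := by
      intro j hj
      rcases hj.lt_or_eq with hj | rfl
      · obtain ⟨r, hr, hok⟩ := below j (by omega)
        have hv := verticalOk_cellAt (δ c.1 (column c.2 0)).2 c.2 (show j ≤ i by omega)
        exact ⟨r, hr, hok.1.trans hv.1.symm, hok.2.1.trans hv.2.1.symm⟩
      · obtain ⟨r, hr, hok⟩ := below i le_rfl
        obtain ⟨t, r₁, r', hok', h₁, h₂⟩ := pair i le_rfl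
        obtain ⟨rfl, rfl⟩ := henc (hr.symm.trans h₁)
        have hflag : r'.2.2.2.2 = 0 := by
          rw [← hok'.2.2.2.1, hok.2.1]
          simp [cellAt]
        refine ⟨r', h₂, ?_, ?_⟩
        · rw [(hok'.2.2.2.2 hflag).1]
          funext k
          have := hlen' k
          simpa [column] using this
        · simp [hflag, cellAt]
    have top : ∀ j ≤ i + 1, ∃ r, τ (i + 1) j = enc (machineStep δ c).1 r ∧
        r.1 = column (machineStep δ c).2 0 ∧ r.2.1 = leftColumn (machineStep δ c).2 j := by
      intro j
      induction j with
      | zero =>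
        intro _
        obtain ⟨r, hr, hmid, -⟩ := row 0 (by omega)
        obtain ⟨r', hr', hok⟩ := below 0 (by omega)
        obtain ⟨-, rfl⟩ := henc (hr.symm.trans hr')
        have hn : r.2.1 = none := hok.2.2.1.2 rfl
        exact ⟨r, hr, (hok.2.2.2 hn).trans hmid, hn⟩
      | succ j ihj =>
        intro hj
        obtain ⟨r, hr, htop, -⟩ := ihj (by omega)
        obtain ⟨r₀, hr₀, hmid, -⟩ := row j (by omega)
        obtain ⟨-, rfl⟩ := henc (hr.symm.trans hr₀)
        obtain ⟨t, r₁, r', hok, h₁, h₂⟩ := pair j (by omega)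
        obtain ⟨rfl, rfl⟩ := henc (hr.symm.trans h₁)
        exact ⟨r', h₂, hok.1.trans htop, by rw [hok.2.1, hmid]; rfl⟩
    intro j hj
    obtain ⟨r, hr, hmid, hflag⟩ := row j hj
    obtain ⟨r₀, hr₀, htop, hleft⟩ := top j hj
    obtain ⟨-, rfl⟩ := henc (hr.symm.trans hr₀)
    have hright : r.2.2.2.1 = column (machineStep δ c).2 (j + 1) := by
      rcases hj.lt_or_eq with hj | rfl
      · obtain ⟨t, r₁, r', hok, h₁, h₂⟩ := pair j (by omega)
        obtain ⟨rfl, rfl⟩ := henc (hr.symm.trans h₁)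
        obtain ⟨r₂, hr₂, hmid₂, -⟩ := row (j + 1) hj
        obtain ⟨-, rfl⟩ := henc (hr₂.symm.trans h₂)
        rw [hok.2.2.1, hmid₂]
      · obtain ⟨t, r₁, r', hok, h₁, h₂⟩ := pair i le_rfl
        obtain ⟨rfl, rfl⟩ := henc (hr.symm.trans h₂)
        rw [(hok.2.2.2.2 (by simp [hflag, cellAt])).2]
        funext k
        have := hlen' k
        simp only [column]
        rw [eq_comm, List.getElem?_eq_none_iff]
        omega
    rw [hr]
    congr 1
    exact Prod.ext htop (Prod.ext hleft (Prod.ext hmid (Prod.ext hright hflag)))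

section Loader

variable [Inhabited Γ] {δ : ℕ → (K → Option Γ) → ℕ × StackOp K Γ} {B : ℕ} {k : K}

theorem iterate_loader (w : List Γ) {n : ℕ} (hn : n ≤ w.length) :
    (machineStep (loader δ B k w))^[n] (B + w.length, fun _ => []) =
      (B + (w.length - n), update (fun _ => []) k (w.drop (w.length - n))) := by
  induction n with
  | zero => simp
  | succ n ih =>
    rw [iterate_succ_apply', ih (by omega)]
    obtain ⟨l, hl⟩ : ∃ l, w.length = n + l + 1 := ⟨w.length - n - 1, by omega⟩
    have h1 : w.length - n = l + 1 := by omega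
    have h2 : w.length - (n + 1) = l := by omega
    have h3 : ¬ B + (l + 1) ≤ B := by omega
    have h4 : B + (l + 1) - 1 - B = l := by omega
    have h5 : l < w.length := by omega
    simp only [h1, h2, machineStep, loader, if_neg h3, h4, StackOp.run, update_self, update_idem]
    rw [List.drop_eq_getElem_cons h5, List.getD_eq_getElem _ _ h5]
    rfl

theorem iterate_loader_of_le (hδ : ∀ s ≤ B, ∀ a, (δ s a).1 ≤ B) (w : List Γ)
    {c : ℕ × (K → List Γ)} (hc : c.1 ≤ B) (n : ℕ) :
    (machineStep (loader δ B k w))^[n] c = (machineStep δ)^[n] c := by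
  induction n generalizing c with
  | zero => rfl
  | succ n ih =>
    have hstep : machineStep (loader δ B k w) c = machineStep δ c := by
      simp [machineStep, loader, hc]
    rw [iterate_succ_apply, iterate_succ_apply, hstep, ih (hδ _ hc _)]

end Loader

section Instance

variable [Finite K] [Finite Γ]

variable (δ : ℕ → (K → Option Γ) → ℕ × StackOp K Γ) (B : ℕ) (k : K)

/-- The vertical relation between tiles with control state at most `B`. -/
noncomputable def verticalList : List (ℕ × ℕ) :=
  (List.range (B + 1)).flatMap fun s =>
    (Set.toFinite {p : Cell K Γ × Cell K Γ | VerticalOk (δ s p.1.1).2 p.1 p.2}).toFinset.toList.map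
      fun p => (tileCode s p.1, tileCode (δ s p.1.1).1 p.2)

theorem mem_verticalList {p : ℕ × ℕ} : p ∈ verticalList δ B ↔ ∃ s ≤ B, ∃ r r',
    VerticalOk (δ s r.1).2 r r' ∧ p = (tileCode s r, tileCode (δ s r.1).1 r') := by
  simp only [verticalList, List.mem_flatMap, List.mem_range, List.mem_map, Finset.mem_toList,
    Set.Finite.mem_toFinset, Set.mem_ofPred_eq, Nat.lt_succ_iff]
  constructor
  · rintro ⟨s, hs, ⟨r, r'⟩, h, rfl⟩
    exact ⟨s, hs, r, r', h, rfl⟩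
  · rintro ⟨s, hs, r, r', h, rfl⟩
    exact ⟨s, hs, (r, r'), h, rfl⟩

variable (Γ) in
/-- The vertical relation between cells when `a` is pushed on stack `k`. -/
noncomputable def pushList (a : Γ) : List (ℕ × ℕ) := codePairs (VerticalOk (StackOp.push k a))

variable [Inhabited Γ]

/-- The vertical relation of the machine `loader δ B k w`. -/
noncomputable def loaderList (w : List Γ) : List (ℕ × ℕ) :=
  verticalList δ B ++ (List.range w.length).flatMap fun l =>
    (pushList Γ k (w.getD l default)).map (withStates (B + l + 1) (B + l))

variable {δ B k}

theorem mem_loaderList {w : List Γ} {p : ℕ × ℕ} : p ∈ loaderList δ B k w ↔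
    ∃ s < B + w.length + 1, ∃ r r', VerticalOk (loader δ B k w s r.1).2 r r' ∧
      p = (tileCode s r, tileCode (loader δ B k w s r.1).1 r') := by
  simp only [loaderList, List.mem_append, List.mem_flatMap, List.mem_range, List.mem_map,
    mem_verticalList, pushList, mem_codePairs]
  constructor
  · rintro (⟨s, hs, r, r', h, rfl⟩ | ⟨l, hl, _, ⟨r, r', h, rfl⟩, rfl⟩)
    · refine ⟨s, by omega, r, r', ?_⟩
      simpa [loader, hs] using h
    · refine ⟨B + l + 1, by omega, r, r', ?_⟩
      have hB : ¬ B + l + 1 ≤ B := by omega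
      have hl' : B + l + 1 - 1 - B = l := by omega
      simp only [loader, if_neg hB, hl']
      exact ⟨h, rfl⟩
  · rintro ⟨s, hs, r, r', h, rfl⟩
    by_cases hB : s ≤ B
    · simp only [loader, if_pos hB] at h ⊢
      exact Or.inl ⟨s, hB, r, r', h, rfl⟩
    · obtain ⟨l, rfl⟩ : ∃ l, s = B + l + 1 := ⟨s - B - 1, by omega⟩
      have hl' : B + l + 1 - 1 - B = l := by omega
      simp only [loader, if_neg hB, hl'] at h ⊢
      exact Or.inr ⟨l, by omega, _, ⟨r, r', h, rfl⟩, rfl⟩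

variable (δ B k) in
/-- The tiling instance which simulates the machine `δ` started in state `B` with the word `w`
on stack `k`; it has a successful tiling when the machine reaches state `h` with empty stacks. -/
noncomputable def machineInstance (h : ℕ) (w : List Γ) : TilingInstance :=
  (Nat.pair (B + w.length + 1) (Nat.card (Cell K Γ)), horizontalList K Γ (B + w.length + 1),
    loaderList δ B k w, tileCode (K := K) (Γ := Γ) (B + w.length) (cellAt (fun _ => []) 0 0),
    tileCode (K := K) (Γ := Γ) h (cellAt (fun _ => []) 1 1))

theorem wellFormed_machineInstance (hδ : ∀ s ≤ B, ∀ a, (δ s a).1 ≤ B) {h : ℕ} (hh : h < B)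
    (w : List Γ) : WellFormed (machineInstance δ B k h w) := by
  refine ⟨tileCode_lt (by omega) _, tileCode_lt (by omega) _, fun p hp => ?_, fun p hp => ?_⟩
  · obtain ⟨s, hs, r, r', -, rfl⟩ := mem_horizontalList.1 hp
    exact ⟨tileCode_lt hs r, tileCode_lt hs r'⟩
  · obtain ⟨s, hs, r, r', -, rfl⟩ := mem_loaderList.1 hp
    exact ⟨tileCode_lt hs r, tileCode_lt (loader_lt hδ hs _) r'⟩

theorem hasSuccessfulTiling_machineInstance_iff (hδ : ∀ s ≤ B, ∀ a, (δ s a).1 ≤ B) {h : ℕ}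
    (hh : h < B) (w : List Γ) : HasSuccessfulTiling (machineInstance δ B k h w) ↔
      ∃ i, (machineStep (loader δ B k w))^[i] (B + w.length, fun _ => []) = (h, fun _ => []) := by
  have final : ∀ i, runTile tileCode (loader δ B k w) (B + w.length) i i =
      tileCode h (cellAt (fun _ : K => ([] : List Γ)) 1 1) ↔
      (machineStep (loader δ B k w))^[i] (B + w.length, fun _ => []) = (h, fun _ => []) := by
    intro i
    rw [runTile, tileCode_injective2.eq_iff, cellAt_diagonal_eq, Prod.ext_iff]
    refine and_congr_right fun hs => and_iff_right ?_
    rintro rfl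
    simp only [iterate_zero, id] at hs
    omega
  have bound : ∀ i, ((machineStep (loader δ B k w))^[i] (B + w.length, fun _ => [])).1 <
      B + w.length + 1 := by
    intro i
    induction i with
    | zero => simp
    | succ i ih =>
      rw [iterate_succ_apply']
      exact loader_lt hδ ih _
  constructor
  · rintro ⟨n, τ, -, hτH, hτV, h0, i, hi, hF⟩
    refine ⟨i, (final i).1
      (hF ▸ (eq_runTile tileCode_injective2 ?_ ?_ hτH hτV h0 hi i le_rfl).symm)⟩
    · intro p hp
      obtain ⟨s, -, r, r', hr⟩ := mem_horizontalList.1 hp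
      exact ⟨s, r, r', hr⟩
    · intro p hp
      obtain ⟨s, -, r, r', hr⟩ := mem_loaderList.1 hp
      exact ⟨s, r, r', hr⟩
  · rintro ⟨n, hn⟩
    refine ⟨n, runTile (tileCode (K := K) (Γ := Γ)) (loader δ B k w) (B + w.length), fun i j _ _ =>
      tileCode_lt (bound i) _, fun i j hj _ => ?_, fun i j hj _ => ?_, rfl, n, le_rfl,
      (final n).2 hn⟩
    · exact mem_horizontalList.2 ⟨_, bound i, _, _,
        horizontalOk_cellAt (length_iterate_le _ _ i) hj, rfl⟩
    · rw [runTile, runTile, iterate_succ_apply']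
      exact mem_loaderList.2 ⟨_, bound i, _, _, verticalOk_cellAt _ _ hj, rfl⟩

theorem machineInstance_iff (hδ : ∀ s ≤ B, ∀ a, (δ s a).1 ≤ B) {h : ℕ} (hh : h < B)
    (w : List Γ) :
    (WellFormed (machineInstance δ B k h w) ∧ HasSuccessfulTiling (machineInstance δ B k h w)) ↔
      ∃ i, (machineStep δ)^[i] (B, update (fun _ => []) k w) = (h, fun _ => []) := by
  rw [and_iff_right (wellFormed_machineInstance hδ hh w),
    hasSuccessfulTiling_machineInstance_iff hδ hh]
  have load : (machineStep (loader δ B k w))^[w.length] (B + w.length, fun _ => []) =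
      (B, update (fun _ => []) k w) := by
    rw [iterate_loader w le_rfl]
    simp
  have run : ∀ i, (machineStep (loader δ B k w))^[i + w.length] (B + w.length, fun _ => []) =
      (machineStep δ)^[i] (B, update (fun _ => []) k w) := fun i => by
    rw [iterate_add_apply, load, iterate_loader_of_le hδ w le_rfl]
  constructor
  · rintro ⟨i, hi⟩
    rcases le_total i w.length with hle | hle
    · rw [iterate_loader w hle, Prod.mk.injEq] at hi
      omega
    · obtain ⟨j, rfl⟩ := Nat.exists_eq_add_of_le' hle
      exact ⟨j, (run j).symm.trans hi⟩
  · rintro ⟨i, hi⟩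
    exact ⟨_, (run i).trans hi⟩

theorem primrec_machineInstance [Primcodable Γ] (h : ℕ) :
    Primrec (machineInstance δ B k h) := by
  have withStates₂ {α : Type} [Primcodable α] {f g : α → ℕ} {L : α → List (ℕ × ℕ)}
      (hf : Primrec f) (hg : Primrec g) (hL : Primrec L) :
      Primrec fun a => (L a).map (withStates (f a) (g a)) := by
    refine Primrec.list_map hL (Primrec.pair (α := α × ℕ × ℕ) ?_ ?_)
    · exact Primrec₂.natPair.comp (hf.comp Primrec.fst) (Primrec.fst.comp Primrec.snd)
    · exact Primrec₂.natPair.comp (hg.comp Primrec.fst) (Primrec.snd.comp Primrec.snd)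
  have hlen : Primrec fun w : List Γ => B + w.length :=
    Primrec.nat_add.comp (Primrec.const B) Primrec.list_length
  have hN : Primrec fun w : List Γ => B + w.length + 1 := Primrec.succ.comp hlen
  refine (Primrec₂.natPair.comp hN (Primrec.const _)).pair (Primrec.pair ?_ (Primrec.pair ?_
    ((Primrec₂.natPair.comp hlen (Primrec.const _)).pair (Primrec.const _))))
  · exact Primrec.list_flatMap (Primrec.list_range.comp hN)
      (withStates₂ (α := List Γ × ℕ) Primrec.snd Primrec.snd (Primrec.const _))
  · refine Primrec.list_append.comp (Primrec.const _) (Primrec.list_flatMap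
      (Primrec.list_range.comp Primrec.list_length) (withStates₂ (α := List Γ × ℕ) ?_ ?_ ?_))
    · exact Primrec.succ.comp (Primrec.nat_add.comp (Primrec.const B) Primrec.snd)
    · exact Primrec.nat_add.comp (Primrec.const B) Primrec.snd
    · exact (Primrec.dom_finite (pushList Γ k)).comp
        ((Primrec.list_getD default).comp Primrec.fst Primrec.snd)

/-- The runs of a machine can be simulated by tiling instances, uniformly in the initial content of
a stack, when the machine stays within a finite set of control states. -/
theorem exists_primrec_tilingInstance [Primcodable Γ] {Q : Type}
    (γ : Q → (K → Option Γ) → Q × StackOp K Γ) (k : K) {X : Set Q} (hX : X.Finite)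
    (hγ : ∀ q ∈ X, ∀ a, (γ q a).1 ∈ X) {q h : Q} (hq : q ∈ X) (hh : h ∈ X) :
    ∃ f : List Γ → TilingInstance, Primrec f ∧ ∀ w, (WellFormed (f w) ∧ HasSuccessfulTiling (f w)) ↔
      ∃ n, (machineStep γ)^[n] (q, update (fun _ => []) k w) = (h, fun _ => []) := by
  have := hX.to_subtype
  let ν := Finite.equivFin X
  let B := Nat.card X
  let δ : ℕ → (K → Option Γ) → ℕ × StackOp K Γ := fun s a =>
    if hs : s < B then
      (ν ⟨_, hγ _ (ν.symm ⟨s, hs⟩).2 a⟩, (γ (ν.symm ⟨s, hs⟩) a).2)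
    else (ν ⟨q, hq⟩, StackOp.nop)
  have hδ : ∀ s ≤ B, ∀ a, (δ s a).1 ≤ B := by
    intro s _ a
    by_cases hs : s < B
    · simp only [δ, dif_pos hs]
      exact (Fin.is_lt _).le
    · simp only [δ, dif_neg hs]
      exact (Fin.is_lt _).le
  have hδν : ∀ (p : X) (a : K → Option Γ), δ (ν p) a = ((ν ⟨_, hγ p p.2 a⟩ : ℕ), (γ p a).2) := by
    intro p a
    obtain ⟨x, rfl⟩ := ν.symm.surjective p
    rw [ν.apply_symm_apply]
    exact dif_pos x.is_lt
  have sim : ∀ (n : ℕ) (p : X) (S : K → List Γ), ∃ p' : X,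
      (machineStep δ)^[n] (ν p, S) = ((ν p' : ℕ), ((machineStep γ)^[n] (p.1, S)).2) ∧
      ((machineStep γ)^[n] (p.1, S)).1 = p' := by
    intro n p S
    induction n with
    | zero => exact ⟨p, rfl, rfl⟩
    | succ n ih =>
      obtain ⟨p', h₁, h₂⟩ := ih
      refine ⟨⟨_, hγ p' p'.2 (column ((machineStep γ)^[n] (p.1, S)).2 0)⟩, ?_, ?_⟩
      · rw [iterate_succ_apply', iterate_succ_apply', h₁]
        simp only [machineStep, hδν, h₂]
      · rw [iterate_succ_apply']
        simp [machineStep, h₂]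
  have start : ∀ S : K → List Γ, machineStep δ (B, S) = ((ν ⟨q, hq⟩ : ℕ), S) := by
    intro S
    simp [machineStep, δ, StackOp.run]
  refine ⟨machineInstance δ B k (ν ⟨h, hh⟩), primrec_machineInstance _, fun w => ?_⟩
  rw [machineInstance_iff hδ (Fin.is_lt _)]
  constructor
  · rintro ⟨n, hn⟩
    cases n with
    | zero =>
      have := congrArg Prod.fst hn
      have hlt := (ν ⟨h, hh⟩).is_lt
      simp only [iterate_zero, id] at this
      omega
    | succ n =>
      rw [iterate_succ_apply, start] at hn
      obtain ⟨p', h₁, h₂⟩ := sim n ⟨q, hq⟩ (update (fun _ => []) k w)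
      rw [h₁, Prod.mk.injEq, Fin.val_inj, ν.injective.eq_iff] at hn
      exact ⟨n, Prod.ext (by rw [h₂, hn.1]) hn.2⟩
  · rintro ⟨n, hn⟩
    refine ⟨n + 1, ?_⟩
    obtain ⟨p', h₁, h₂⟩ := sim n ⟨q, hq⟩ (update (fun _ => []) k w)
    rw [hn] at h₁ h₂
    obtain rfl : p' = ⟨h, hh⟩ := Subtype.ext h₂.symm
    rw [iterate_succ_apply, start, h₁]

end Instance

end Machine

section StackMachine

variable {K Γ Λ σ : Type}

open TM2 TM2.Stmt in
/-- The transition function which executes the statements of a `TM2` machine one at a time. -/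
def stmtStep (M : Λ → Stmt (fun _ : K => Γ) Λ σ) (v₀ : σ) :
    Option (Stmt (fun _ : K => Γ) Λ σ) × σ → (K → Option Γ) →
      (Option (Stmt (fun _ : K => Γ) Λ σ) × σ) × StackOp K Γ
  | (some (push k f q), v), _ => ((some q, v), StackOp.push k (f v))
  | (some (peek k f q), v), a => ((some q, f v (a k)), StackOp.nop)
  | (some (pop k f q), v), a => ((some q, f v (a k)), StackOp.pop k)
  | (some (load f q), v), _ => ((some q, f v), StackOp.nop)
  | (some (branch f q₁ q₂), v), _ => ((some (cond (f v) q₁ q₂), v), StackOp.nop)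
  | (some (goto l), v), _ => ((some (M (l v)), v), StackOp.nop)
  | (some halt, _), _ => ((none, v₀), StackOp.clear)
  | (none, _), _ => ((none, v₀), StackOp.clear)

/-- The statements reachable from a supporting set of labels are closed under execution. -/
theorem stmtStep_mem_stmts [Inhabited Λ] {M : Λ → TM2.Stmt (fun _ : K => Γ) Λ σ} (v₀ : σ)
    {S : Finset Λ} (hS : TM2.Supports M S) {x : Option (TM2.Stmt (fun _ : K => Γ) Λ σ) × σ}
    (hx : x.1 ∈ TM2.stmts M S) (a : K → Option Γ) : (stmtStep M v₀ x a).1.1 ∈ TM2.stmts M S := by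
  obtain ⟨_ | q, v⟩ := x
  · exact hx
  · cases q with
    | push k f q | peek k f q | pop k f q | load f q =>
      exact TM2.stmts_trans (by simp [TM2.stmts₁, TM2.stmts₁_self]) hx
    | branch f q₁ q₂ =>
      refine TM2.stmts_trans ?_ hx
      cases h : f v <;> simp [TM2.stmts₁, TM2.stmts₁_self]
    | goto l =>
      have := TM2.stmts_supportsStmt hS hx v
      simp only [stmtStep, TM2.stmts, Finset.mem_insertNone, Finset.mem_biUnion, Option.mem_def,
        Option.some.injEq, forall_eq']
      exact ⟨_, this, TM2.stmts₁_self⟩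
    | halt => simp [stmtStep, TM2.stmts]

variable [DecidableEq K] (M : Λ → TM2.Stmt (fun _ : K => Γ) Λ σ) (v₀ : σ)

/-- The machine `stmtStep M v₀`, halting when there is no statement left to execute. -/
def stmtStepOption (c : (Option (TM2.Stmt (fun _ : K => Γ) Λ σ) × σ) × (K → List Γ)) :
    Option ((Option (TM2.Stmt (fun _ : K => Γ) Λ σ) × σ) × (K → List Γ)) :=
  c.1.1.map fun _ => machineStep (stmtStep M v₀) c

/-- The configuration of `stmtStep M v₀` which corresponds to a configuration of `M`. -/
def stmtCfg : TM2.Cfg (fun _ : K => Γ) Λ σ →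
    (Option (TM2.Stmt (fun _ : K => Γ) Λ σ) × σ) × (K → List Γ)
  | ⟨some l, v, S⟩ => ((some (M l), v), S)
  | ⟨none, _, _⟩ => ((none, v₀), fun _ => [])

theorem reaches₁_stmtCfg (q : TM2.Stmt (fun _ : K => Γ) Λ σ) (v : σ) (S : K → List Γ) :
    StateTransition.Reaches₁ (stmtStepOption M v₀) ((some q, v), S)
      (stmtCfg M v₀ (TM2.stepAux q v S)) := by
  induction q generalizing v S with
  | push k f q ih => exact Relation.TransGen.head rfl (ih v _)
  | peek k f q ih =>
    refine Relation.TransGen.head rfl ?_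
    simpa [StateTransition.Reaches₁, machineStep, stmtStep, StackOp.run, column,
      List.head?_eq_getElem?] using ih _ S
  | pop k f q ih =>
    refine Relation.TransGen.head rfl ?_
    simpa [StateTransition.Reaches₁, machineStep, stmtStep, StackOp.run, column,
      List.head?_eq_getElem?] using ih _ _
  | load f q ih => exact Relation.TransGen.head rfl (ih _ S)
  | branch f q₁ q₂ ih₁ ih₂ =>
    refine Relation.TransGen.head rfl ?_
    cases h : f v
    · simpa [StateTransition.Reaches₁, machineStep, stmtStep, StackOp.run, h] using ih₂ v S
    · simpa [StateTransition.Reaches₁, machineStep, stmtStep, StackOp.run, h] using ih₁ v S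
  | goto l => exact Relation.TransGen.single rfl
  | halt => exact Relation.TransGen.single rfl

theorem eval_dom_iff_stmtStepOption (c : TM2.Cfg (fun _ : K => Γ) Λ σ) :
    (StateTransition.eval (TM2.step M) c).Dom ↔
      (StateTransition.eval (stmtStepOption M v₀) (stmtCfg M v₀ c)).Dom := by
  refine (StateTransition.tr_eval_dom (tr := fun a b => stmtCfg M v₀ a = b)
    (StateTransition.fun_respects.2 ?_) rfl).symm
  rintro ⟨_ | l, v, S⟩
  · rfl
  · exact reaches₁_stmtCfg M v₀ (M l) v S

theorem eval_stmtStepOption_dom_iff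
    (c : (Option (TM2.Stmt (fun _ : K => Γ) Λ σ) × σ) × (K → List Γ)) :
    (StateTransition.eval (stmtStepOption M v₀) c).Dom ↔
      ∃ n, (machineStep (stmtStep M v₀))^[n] c = ((none, v₀), fun _ => []) := by
  constructor
  · intro h
    obtain ⟨hreach, hhalt⟩ := StateTransition.mem_eval.1 (Part.get_mem h)
    generalize (StateTransition.eval (stmtStepOption M v₀) c).get h = d at hreach hhalt
    induction hreach using Relation.ReflTransGen.head_induction_on with
    | refl =>
      obtain ⟨⟨_ | q, v⟩, S⟩ := d
      · exact ⟨1, rfl⟩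
      · simp [stmtStepOption] at hhalt
    | @head a b hab _ ih =>
      obtain ⟨n, hn⟩ := ih (by
        rw [← StateTransition.reaches_eval (Relation.ReflTransGen.single hab)]
        exact h)
      obtain ⟨⟨_ | q, v⟩, S⟩ := a
      · simp [stmtStepOption] at hab
      · obtain rfl : machineStep (stmtStep M v₀) ((some q, v), S) = b := Option.some.inj hab
        exact ⟨n + 1, hn⟩
  · rintro ⟨n, hn⟩
    induction n generalizing c with
    | zero =>
      obtain rfl : c = _ := hn
      exact Part.dom_iff_mem.2 ⟨_, StateTransition.mem_eval.2 ⟨Relation.ReflTransGen.refl, rfl⟩⟩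
    | succ n ih =>
      obtain ⟨⟨_ | q, v⟩, S⟩ := c
      · exact Part.dom_iff_mem.2 ⟨_, StateTransition.mem_eval.2 ⟨Relation.ReflTransGen.refl, rfl⟩⟩
      · have hstep : StateTransition.Reaches (stmtStepOption M v₀) ((some q, v), S)
            (machineStep (stmtStep M v₀) ((some q, v), S)) := Relation.ReflTransGen.single rfl
        rw [StateTransition.reaches_eval hstep]
        exact ih _ hn

end StackMachine

section Input

open PartrecToTM2

noncomputable instance : Primcodable Γ' := Primcodable.ofEquiv _ (Finite.equivFin Γ')

instance : Finite K' :=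
  Finite.of_injective (fun | .main => 0 | .rev => 1 | .aux => 2 | .stack => 3 : K' → Fin 4)
    (by rintro ⟨⟩ ⟨⟩ h <;> first | rfl | simp at h)

theorem trNat_eq_cons {n : ℕ} (hn : n ≠ 0) :
    trNat n = (bif n.bodd then Γ'.bit1 else Γ'.bit0) :: trNat (n / 2) := by
  have pos : ∀ p : PosNum, trNat (p : ℕ) = trPosNum p := fun p => by
    rw [trNat, PosNum.of_to_nat]
    rfl
  obtain ⟨p, rfl⟩ : ∃ p : PosNum, (p : ℕ) = n := by
    cases h : (n : Num) with
    | zero =>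
      have := Num.to_of_nat n
      rw [h] at this
      exact absurd this.symm hn
    | pos p => exact ⟨p, by rw [← Num.to_of_nat n, h]; rfl⟩
  rw [pos]
  cases p with
  | one => simp [trPosNum]
  | bit0 p =>
    have h : ((PosNum.bit0 p : PosNum) : ℕ) / 2 = p := by
      rw [PosNum.cast_bit0]
      omega
    rw [h, pos]
    simp [trPosNum, Nat.bodd_add]
  | bit1 p =>
    have h : ((PosNum.bit1 p : PosNum) : ℕ) / 2 = p := by
      rw [PosNum.cast_bit1]
      omega
    rw [h, pos]
    simp [trPosNum, Nat.bodd_add]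

theorem primrec_trNat : Primrec trNat := by
  have hrec : Primrec₂ fun (_ : Unit) (n : ℕ) => trNat n := by
    refine Primrec.nat_strong_rec _ (g := fun _ l => if l.length = 0 then some [] else
      (l[l.length / 2]?).map fun t =>
        (bif l.length.bodd then Γ'.bit1 else Γ'.bit0) :: t) ?_ ?_
    · have hlen : Primrec fun x : Unit × List (List Γ') => x.2.length :=
        Primrec.list_length.comp Primrec.snd
      refine Primrec.ite (Primrec.eq.comp hlen (Primrec.const 0)) (Primrec.const _)
        (Primrec.option_map (Primrec.list_getElem?.comp Primrec.snd
          (Primrec.nat_div.comp hlen (Primrec.const 2))) ?_)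
      exact Primrec.list_cons.comp (Primrec.cond (Primrec.nat_bodd.comp (hlen.comp Primrec.fst))
        (Primrec.const _) (Primrec.const _)) Primrec.snd
    · intro _ n
      rcases eq_or_ne n 0 with rfl | hn
      · simp
      · have : n / 2 < n := by omega
        simp [hn, this, ← trNat_eq_cons]
  exact hrec.comp (Primrec.const ()) Primrec.id

end Input

end OctantTiling

open OctantTiling PartrecToTM2 in
/-- The unbounded octant tiling problem is undecidable: the predicate
"the instance is well-formed and admits a successful tiling of some octant"
is not computable. -/
theorem octant_tiling_undecidable :
    ¬ ComputablePred (fun I : TilingInstance => WellFormed I ∧ HasSuccessfulTiling I) := by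
  intro hT
  let F : ℕ →. ℕ := fun n => (Denumerable.ofNat Nat.Partrec.Code n).eval 0
  have hF : Partrec F := Nat.Partrec.Code.eval_part.comp (Computable.ofNat _) (Computable.const 0)
  obtain ⟨c, hc⟩ := ToPartrec.Code.exists_code (Nat.Partrec'.part_iff₁.2 hF)
  let l := trNormal c Cont'.halt
  let _ : Inhabited Λ' := ⟨l⟩
  have hsupp : TM2.Supports tr (codeSupp c Cont'.halt) := tr_supports c Cont'.halt
  obtain ⟨f, hf, hfiff⟩ := exists_primrec_tilingInstance (stmtStep tr none) K'.main
    (X := {x | x.1 ∈ TM2.stmts tr (codeSupp c Cont'.halt)})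
    (((Finset.finite_toSet _).prod Set.finite_univ).subset fun x hx => ⟨hx, Set.mem_univ _⟩)
    (fun x hx a => stmtStep_mem_stmts none hsupp hx a) (q := (some (tr l), none))
    (h := (none, none)) (by
      simp only [Set.mem_ofPred_eq, TM2.stmts, Finset.mem_insertNone, Finset.mem_biUnion,
        Option.mem_def]
      intro a ha
      obtain rfl := Option.some.inj ha
      exact ⟨l, hsupp.1, TM2.stmts₁_self⟩) (by simp [TM2.stmts])
  refine ComputablePred.halting_problem 0 (ComputablePred.computable_of_manyOneReducible
    ⟨fun d => f (trList [Encodable.encode d]), ?_, fun d => ?_⟩ hT)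
  · exact hf.to_comp.comp (Primrec.list_append.comp (primrec_trNat.comp Primrec.encode)
      (Primrec.const [Γ'.cons])).to_comp
  · have hinit : stmtCfg tr none (init c [Encodable.encode d]) =
        ((some (tr l), none), update (fun _ => []) K'.main (trList [Encodable.encode d])) := by
      refine Prod.ext rfl (funext fun k => ?_)
      cases k <;> rfl
    have hdom := (eval_dom_iff_stmtStepOption tr none (init c [Encodable.encode d])).trans
      (eval_stmtStepOption_dom_iff tr none _)
    rw [hinit, tr_eval] at hdom
    refine Iff.trans ?_ (hdom.trans (hfiff _).symm)
    have := hc ⟨[Encodable.encode d], rfl⟩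
    simp only [F] at this
    rw [this]
    simp [List.Vector.head]
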